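/- Let (R, m, k) be a commutative noetherian local Cohen–Macaulay ring admitting a dualizing module, and let C be a semidualizing R-module. If there exists an R-module M with finite depth such that the P_C-projective dimension of M and the I_C-injective dimension of M are both finite, then R is Gorenstein. (This answers affirmatively the question of Takahashi and White.) -/

import Mathlib

/-! ## Statement 2: the question of Takahashi and White

Module-theoretic notions over a commutative noetherian local ring `(R, m, k)`. -/

open CategoryTheory Limits

/-- The Ext-module `Ext^i_R(A, B)`. -/
noncomputable def extGroup (R : Type) [CommRing R] (i : ℕ)
    (A B : Type) [AddCommGroup A] [Module R A] [AddCommGroup B] [Module R B] :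
    ModuleCat R :=
  ((Ext R (ModuleCat.{0} R) i).obj (Opposite.op (ModuleCat.of R A))).obj (ModuleCat.of R B)

/-- `C` is a semidualizing `R`-module: `C` is finitely generated, the natural
homothety map `R → Hom_R(C, C)`, `r ↦ r • id`, is bijective, and
`Ext^i_R(C, C) = 0` for all `i ≥ 1`. -/
def IsSemidualizingModule (R : Type) [CommRing R]
    (C : Type) [AddCommGroup C] [Module R C] : Prop :=
  Module.Finite R C ∧
  Function.Bijective (LinearMap.toSpanSingleton R (C →ₗ[R] C) LinearMap.id) ∧
  ∀ i : ℕ, 1 ≤ i → Subsingleton (extGroup R i C C)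

/-- The injective dimension of the `R`-module `M` is at most `n`: `M` has an
injective coresolution `0 → M → J^0 → ⋯ → J^n → 0`, i.e. a quasi-isomorphism
from `M` (as a complex concentrated in degree `0`) to a complex `J` of
injective modules vanishing above degree `n`. -/
def ModuleInjDimLE (R : Type) [CommRing R]
    (M : Type) [AddCommGroup M] [Module R M] (n : ℕ) : Prop :=
  ∃ (J : CochainComplex (ModuleCat.{0} R) ℕ)
    (f : (HomologicalComplex.single (ModuleCat.{0} R) (ComplexShape.up ℕ) 0).obj
        (ModuleCat.of R M) ⟶ J),
    QuasiIso f ∧ (∀ i : ℕ, Module.Injective R (J.X i)) ∧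
      (∀ i : ℕ, n < i → IsZero (J.X i))

/-- `P_C-pd_R(M) ≤ n`: `M` has a resolution of length at most `n` by modules of
the form `C ⊗_R P` with `P` projective. -/
def PCpdLE (R : Type) [CommRing R] (C : Type) [AddCommGroup C] [Module R C]
    (M : Type) [AddCommGroup M] [Module R M] (n : ℕ) : Prop :=
  ∃ (G : ChainComplex (ModuleCat.{0} R) ℕ)
    (f : G ⟶ (HomologicalComplex.single (ModuleCat.{0} R) (ComplexShape.down ℕ) 0).obj
        (ModuleCat.of R M)),
    QuasiIso f ∧
    (∀ i : ℕ, ∃ (P : Type) (_ : AddCommGroup P) (_ : Module R P),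
        Module.Projective R P ∧ Nonempty (G.X i ≅ ModuleCat.of R (TensorProduct R C P))) ∧
    (∀ i : ℕ, n < i → IsZero (G.X i))

/-- `I_C-id_R(M) ≤ n`: `M` has a coresolution of length at most `n` by modules
of the form `Hom_R(C, I)` with `I` injective. -/
def ICidLE (R : Type) [CommRing R] (C : Type) [AddCommGroup C] [Module R C]
    (M : Type) [AddCommGroup M] [Module R M] (n : ℕ) : Prop :=
  ∃ (J : CochainComplex (ModuleCat.{0} R) ℕ)
    (f : (HomologicalComplex.single (ModuleCat.{0} R) (ComplexShape.up ℕ) 0).obj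
        (ModuleCat.of R M) ⟶ J),
    QuasiIso f ∧
    (∀ i : ℕ, ∃ (I : Type) (_ : AddCommGroup I) (_ : Module R I),
        Module.Injective R I ∧ Nonempty (J.X i ≅ ModuleCat.of R (C →ₗ[R] I))) ∧
    (∀ i : ℕ, n < i → IsZero (J.X i))

namespace TW

open Abelian

section ExtTools

variable {R : Type} [CommRing R]

/-- Vanishing of `Ext^i_R(A, X)`. -/
def XZ (R : Type) [CommRing R] (A X : Type) [AddCommGroup A] [Module R A]
    [AddCommGroup X] [Module R X] (i : ℕ) : Prop :=
  Subsingleton (Abelian.Ext (ModuleCat.of R A) (ModuleCat.of R X) i)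

/-- A concrete short exact sequence. -/
structure SES {R : Type} [CommRing R] {X₁ X₂ X₃ : Type} [AddCommGroup X₁] [Module R X₁]
    [AddCommGroup X₂] [Module R X₂] [AddCommGroup X₃] [Module R X₃]
    (f : X₁ →ₗ[R] X₂) (g : X₂ →ₗ[R] X₃) : Prop where
  inj : Function.Injective f
  exact : Function.Exact f g
  surj : Function.Surjective g

variable {A X Y X₁ X₂ X₃ : Type} [AddCommGroup A] [Module R A]
  [AddCommGroup X] [Module R X] [AddCommGroup Y] [Module R Y]
  [AddCommGroup X₁] [Module R X₁]
  [AddCommGroup X₂] [Module R X₂] [AddCommGroup X₃] [Module R X₃]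
  {f : X₁ →ₗ[R] X₂} {g : X₂ →ₗ[R] X₃}

/-- The short complex attached to a concrete short exact sequence. -/
noncomputable abbrev SES.sc (h : SES f g) : ShortComplex (ModuleCat.{0} R) :=
  ShortComplex.mk (ModuleCat.ofHom f) (ModuleCat.ofHom g) (by
    ext x; exact h.exact.apply_apply_eq_zero x)

lemma SES.shortExact (h : SES f g) : h.sc.ShortExact where
  exact := (ShortComplex.ShortExact.moduleCat_exact_iff_function_exact _).2 h.exact
  mono_f := (ModuleCat.mono_iff_injective _).2 h.inj
  epi_g := (ModuleCat.epi_iff_surjective _).2 h.surj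

lemma XZ.mid (h : SES f g) {i : ℕ} (h₁ : XZ R A X₁ i) (h₃ : XZ R A X₃ i) : XZ R A X₂ i := by
  unfold XZ at *
  refine subsingleton_of_forall_eq 0 fun x => ?_
  obtain ⟨y, hy⟩ := Ext.covariant_sequence_exact₂ _ h.shortExact (n := i) x
    (Subsingleton.elim (α := Ext (ModuleCat.of R A) (ModuleCat.of R X₃) i) _ _)
  rw [← hy, Subsingleton.elim (α := Ext (ModuleCat.of R A) (ModuleCat.of R X₁) i) y 0]
  simp

lemma XZ.right (h : SES f g) {i : ℕ} (h₂ : XZ R A X₂ i) (h₁ : XZ R A X₁ (i + 1)) :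
    XZ R A X₃ i := by
  unfold XZ at *
  refine subsingleton_of_forall_eq 0 fun x => ?_
  obtain ⟨y, hy⟩ := Ext.covariant_sequence_exact₃ _ h.shortExact (n₀ := i) x rfl
    (Subsingleton.elim (α := Ext (ModuleCat.of R A) (ModuleCat.of R X₁) (i+1)) _ _)
  rw [← hy, Subsingleton.elim (α := Ext (ModuleCat.of R A) (ModuleCat.of R X₂) i) y 0]
  simp

lemma XZ.left (h : SES f g) {i : ℕ} (h₂ : XZ R A X₂ (i + 1)) (h₃ : XZ R A X₃ i) :
    XZ R A X₁ (i + 1) := by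
  unfold XZ at *
  refine subsingleton_of_forall_eq 0 fun x => ?_
  obtain ⟨y, hy⟩ := Ext.covariant_sequence_exact₁ _ h.shortExact (n₁ := i + 1) x
    (Subsingleton.elim (α := Ext (ModuleCat.of R A) (ModuleCat.of R X₂) (i+1)) _ _) rfl
  rw [← hy, Subsingleton.elim (α := Ext (ModuleCat.of R A) (ModuleCat.of R X₃) i) y 0]
  simp

lemma XZ.left_of_zero (h : SES f g) {i : ℕ}
    (h₂ : ∀ x : Ext (ModuleCat.of R A) (ModuleCat.of R X₁) (i + 1),
      x.comp (Ext.mk₀ (ModuleCat.ofHom f)) (add_zero _) = 0) (h₃ : XZ R A X₃ i) :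
    XZ R A X₁ (i + 1) := by
  unfold XZ at *
  refine subsingleton_of_forall_eq 0 fun x => ?_
  obtain ⟨y, hy⟩ := Ext.covariant_sequence_exact₁ _ h.shortExact (n₁ := i + 1) x
    (h₂ x) rfl
  rw [← hy, Subsingleton.elim (α := Ext (ModuleCat.of R A) (ModuleCat.of R X₃) i) y 0]
  simp

lemma XZ.left_one (h : SES f g) (h₂ : XZ R A X₂ 1)
    (hs : ∀ u : A →ₗ[R] X₃, ∃ v : A →ₗ[R] X₂, g ∘ₗ v = u) :
    XZ R A X₁ 1 := by
  unfold XZ at *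
  refine subsingleton_of_forall_eq 0 fun x => ?_
  obtain ⟨y, hy⟩ := Ext.covariant_sequence_exact₁ _ h.shortExact (n₁ := 1) x
    (Subsingleton.elim (α := Ext (ModuleCat.of R A) (ModuleCat.of R X₂) (1)) _ _) (zero_add 1)
  obtain ⟨u, rfl⟩ := (Ext.mk₀_bijective _ _).2 y
  obtain ⟨v, hv⟩ := hs u.hom
  have : u = ModuleCat.ofHom v ≫ h.sc.g := by
    ext x; simp [← hv]
  rw [← hy, this, ← Ext.mk₀_comp_mk₀, Ext.comp_assoc _ _ _ (zero_add 0) (zero_add 1) (by simp)]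
  simp [h.shortExact.comp_extClass]

lemma XZ.hom_surj (h : SES f g) (h₁ : XZ R A X₁ 1) :
    ∀ u : A →ₗ[R] X₃, ∃ v : A →ₗ[R] X₂, g ∘ₗ v = u := by
  unfold XZ at *
  intro u
  obtain ⟨y, hy⟩ := Ext.covariant_sequence_exact₃ _ h.shortExact (n₀ := 0)
    (Ext.mk₀ (ModuleCat.ofHom u)) (zero_add 1)
    (Subsingleton.elim (α := Ext (ModuleCat.of R A) (ModuleCat.of R X₁) (1)) _ _)
  obtain ⟨v, rfl⟩ := (Ext.mk₀_bijective _ _).2 y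
  rw [Ext.mk₀_comp_mk₀] at hy
  have := (Ext.mk₀_bijective _ _).1 hy
  refine ⟨v.hom, ?_⟩
  have h2 := congrArg ModuleCat.Hom.hom this
  simpa using h2

lemma XZ.contra_right (h : SES f g) {i : ℕ} (h₁ : XZ R X₁ A i) (h₂ : XZ R X₂ A (i + 1)) :
    XZ R X₃ A (i + 1) := by
  unfold XZ at *
  refine subsingleton_of_forall_eq 0 fun x => ?_
  obtain ⟨y, hy⟩ := Ext.contravariant_sequence_exact₃ h.shortExact _ (n₁ := i + 1) x
    (Subsingleton.elim (α := Ext (ModuleCat.of R X₂) (ModuleCat.of R A) (i+1)) _ _)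
    (add_comm 1 i)
  rw [← hy, Subsingleton.elim (α := Ext (ModuleCat.of R X₁) (ModuleCat.of R A) i) y 0]
  simp

lemma XZ.contra_left (h : SES f g) {i : ℕ} (h₂ : XZ R X₂ A i) (h₃ : XZ R X₃ A (i + 1)) :
    XZ R X₁ A i := by
  unfold XZ at *
  refine subsingleton_of_forall_eq 0 fun x => ?_
  obtain ⟨y, hy⟩ := Ext.contravariant_sequence_exact₁ h.shortExact _ (n₀ := i) x
    (add_comm 1 i)
    (Subsingleton.elim (α := Ext (ModuleCat.of R X₃) (ModuleCat.of R A) (i+1)) _ _)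
  rw [← hy, Subsingleton.elim (α := Ext (ModuleCat.of R X₂) (ModuleCat.of R A) i) y 0]
  simp

lemma XZ.contra_surj (h : SES f g) (h₃ : XZ R X₃ A 1) :
    ∀ u : X₁ →ₗ[R] A, ∃ v : X₂ →ₗ[R] A, v ∘ₗ f = u := by
  unfold XZ at *
  intro u
  obtain ⟨y, hy⟩ := Ext.contravariant_sequence_exact₁ h.shortExact _ (n₀ := 0)
    (Ext.mk₀ (ModuleCat.ofHom u)) (add_zero 1)
    (Subsingleton.elim (α := Ext (ModuleCat.of R X₃) (ModuleCat.of R A) (1)) _ _)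
  obtain ⟨v, rfl⟩ := (Ext.mk₀_bijective _ _).2 y
  rw [Ext.mk₀_comp_mk₀] at hy
  have := (Ext.mk₀_bijective _ _).1 hy
  refine ⟨v.hom, ?_⟩
  have h2 := congrArg ModuleCat.Hom.hom this
  simpa using h2

lemma XZ.contra_one (h : SES f g) (h₂ : XZ R X₂ A 1)
    (hs : ∀ u : X₁ →ₗ[R] A, ∃ v : X₂ →ₗ[R] A, v ∘ₗ f = u) :
    XZ R X₃ A 1 := by
  unfold XZ at *
  refine subsingleton_of_forall_eq 0 fun x => ?_
  obtain ⟨y, hy⟩ := Ext.contravariant_sequence_exact₃ h.shortExact _ (n₁ := 1) x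
    (Subsingleton.elim (α := Ext (ModuleCat.of R X₂) (ModuleCat.of R A) (1)) _ _)
    (add_zero 1)
  obtain ⟨u, rfl⟩ := (Ext.mk₀_bijective _ _).2 y
  obtain ⟨v, hv⟩ := hs u.hom
  have : u = h.sc.f ≫ ModuleCat.ofHom v := by
    ext x; simp [← hv]
  rw [← hy, this, ← Ext.mk₀_comp_mk₀, ← Ext.comp_assoc _ _ _ (add_zero 1) (add_zero 0) (by simp)]
  simp [h.shortExact.extClass_comp]

lemma XZ.of_projective [Module.Projective R A] (i : ℕ) : XZ R A X (i + 1) := by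
  have : Projective (ModuleCat.of R A) := ModuleCat.projective_of_categoryTheory_projective _
  exact Ext.subsingleton_of_projective _ _ _

lemma XZ.of_injective [Module.Injective R X] (i : ℕ) : XZ R A X (i + 1) := by
  have : Injective (ModuleCat.of R X) := Module.injective_object_of_injective_module R X
  exact Ext.subsingleton_of_injective _ _ _

lemma XZ.retract {n : ℕ} (p : Fin n → (X →ₗ[R] Y)) (s : Fin n → (Y →ₗ[R] X))
    (h : ∑ j, s j ∘ₗ p j = LinearMap.id) {i : ℕ} (hY : XZ R A Y i) : XZ R A X i := by
  unfold XZ at *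
  refine subsingleton_of_forall_eq 0 fun x => ?_
  have h1 : (𝟙 (ModuleCat.of R X)) = ∑ j, (ModuleCat.ofHom (p j) ≫ ModuleCat.ofHom (s j)) := by
    apply ModuleCat.hom_ext
    rw [ModuleCat.hom_sum]
    simp [← h]
  rw [← Ext.comp_mk₀_id x, h1, Ext.mk₀_sum, Ext.comp_sum]
  refine Finset.sum_eq_zero fun j _ => ?_
  rw [← Ext.mk₀_comp_mk₀, ← Ext.comp_assoc _ _ _ (add_zero i) (add_zero 0) (by simp),
    Subsingleton.elim (x.comp (Ext.mk₀ (ModuleCat.ofHom (p j))) (add_zero i)) 0]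
  simp

lemma XZ.of_equiv (e : X ≃ₗ[R] Y) {i : ℕ} (hX : XZ R A X i) : XZ R A Y i :=
  XZ.retract (n := 1) (fun _ => e.symm.toLinearMap) (fun _ => e.toLinearMap) (by simp) hX

end ExtTools

end TW

namespace TW

open Abelian TensorProduct

section Classes

variable {R : Type} [CommRing R]

/-- Vanishing of `Ext^i_R(C, X)` for `i ≥ 1`. -/
def EE (R : Type) [CommRing R] (C X : Type) [AddCommGroup C] [Module R C]
    [AddCommGroup X] [Module R X] : Prop := ∀ i : ℕ, XZ R C X (i + 1)

/-- Vanishing of `Tor_i^R(C, X)` for `i ≥ 1`, expressed through the character module. -/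
def TT (R : Type) [CommRing R] (C X : Type) [AddCommGroup C] [Module R C]
    [AddCommGroup X] [Module R X] : Prop := EE R C (CharacterModule X)

variable {C X Y X₁ X₂ X₃ : Type} [AddCommGroup C] [Module R C]
  [AddCommGroup X] [Module R X] [AddCommGroup Y] [Module R Y]
  [AddCommGroup X₁] [Module R X₁]
  [AddCommGroup X₂] [Module R X₂] [AddCommGroup X₃] [Module R X₃]
  {f : X₁ →ₗ[R] X₂} {g : X₂ →ₗ[R] X₃}

/-- Post-composition. -/
def pc (C : Type) [AddCommGroup C] [Module R C] (f : X →ₗ[R] Y) :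
    (C →ₗ[R] X) →ₗ[R] (C →ₗ[R] Y) where
  toFun u := f ∘ₗ u
  map_add' u v := by ext; simp
  map_smul' r u := by ext; simp

@[simp] lemma pc_apply (f : X →ₗ[R] Y) (u : C →ₗ[R] X) : pc C f u = f ∘ₗ u := rfl

lemma SES.pc_inj (h : SES f g) : Function.Injective (pc C f) := by
  intro u v huv
  ext x
  exact h.inj (LinearMap.congr_fun huv x)

lemma SES.pc_exact (h : SES f g) : Function.Exact (pc C f) (pc C g) := by
  intro u
  constructor
  · intro hu
    have hx : ∀ x, ∃ y, f y = u x := fun x => (h.exact (u x)).1 (LinearMap.congr_fun hu x)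
    choose v hv using hx
    refine ⟨⟨⟨v, fun a b => h.inj (by simp [hv])⟩, fun r a => h.inj (by simp [hv])⟩, ?_⟩
    ext x
    exact hv x
  · rintro ⟨v, rfl⟩
    ext x
    exact h.exact.apply_apply_eq_zero _

lemma SES.pc (h : SES f g) (hE : XZ R C X₁ 1) : SES (pc C f) (pc C g) :=
  ⟨h.pc_inj, h.pc_exact, fun u => XZ.hom_surj h hE u⟩

lemma SES.tensor (h : SES f g) (hi : Function.Injective (f.lTensor C)) :
    SES (f.lTensor C) (g.lTensor C) :=
  ⟨hi, lTensor_exact _ h.exact h.surj, LinearMap.lTensor_surjective _ h.surj⟩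

lemma SES.dual (h : SES f g) : SES (CharacterModule.dual g) (CharacterModule.dual f) := by
  refine ⟨CharacterModule.dual_injective_of_surjective _ h.surj, ?_,
    CharacterModule.dual_surjective_of_injective _ h.inj⟩
  intro φ
  constructor
  · intro hφ
    have hk : ∀ x, g x = 0 → φ x = 0 := by
      intro x hx
      obtain ⟨y, rfl⟩ := (h.exact x).1 hx
      exact DFunLike.congr_fun hφ y
    have hd : ∀ x y, g x = g y → φ x = φ y := fun x y hxy => by
      have := hk (x - y) (by simp [hxy])
      rw [map_sub] at this
      exact sub_eq_zero.1 this
    have hs := Function.surjInv_eq h.surj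
    refine ⟨AddMonoidHom.mk' (fun z => φ (Function.surjInv h.surj z)) fun a b => ?_, ?_⟩
    · rw [← map_add]
      apply hd
      simp [hs]
    · ext x
      exact hd _ _ (hs _)
  · rintro ⟨ψ, rfl⟩
    ext x
    change ψ (g (f x)) = 0
    rw [h.exact.apply_apply_eq_zero]
    exact map_zero ψ

lemma EE.right (h : SES f g) (h₁ : EE R C X₁) (h₂ : EE R C X₂) : EE R C X₃ :=
  fun i => XZ.right h (h₂ i) (h₁ (i + 1))

lemma EE.left (h : SES f g) (h₂ : EE R C X₂) (h₃ : EE R C X₃)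
    (hs : Function.Surjective (TW.pc C g)) : EE R C X₁
  | 0 => XZ.left_one h (h₂ 0) hs
  | i + 1 => XZ.left h (h₂ (i + 1)) (h₃ i)

lemma hom_dual_surj_iff (f : X₁ →ₗ[R] X₂) :
    Function.Surjective (pc C (CharacterModule.dual f)) ↔
      Function.Injective (f.lTensor C) := by
  rw [← CharacterModule.dual_surjective_iff_injective]
  constructor
  · intro h χ
    obtain ⟨v, hv⟩ := h (CharacterModule.curry χ)
    refine ⟨CharacterModule.uncurry v, ?_⟩
    apply CharacterModule.homEquiv.symm.injective
    refine Eq.trans ?_ hv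
    ext c x
    rfl
  · intro h u
    obtain ⟨χ, hχ⟩ := h (CharacterModule.uncurry u)
    refine ⟨CharacterModule.curry χ, ?_⟩
    ext c x
    have := DFunLike.congr_fun hχ (c ⊗ₜ x)
    exact this

lemma TT.inj (h : SES f g) (h₃ : TT R C X₃) : Function.Injective (f.lTensor C) :=
  (hom_dual_surj_iff f).1 (fun u => XZ.hom_surj h.dual (h₃ 0) u)

lemma TT.right (h : SES f g) (h₁ : TT R C X₁) (h₂ : TT R C X₂)
    (hi : Function.Injective (f.lTensor C)) : TT R C X₃ :=
  EE.left h.dual h₂ h₁ ((hom_dual_surj_iff f).2 hi)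

lemma TT.left (h : SES f g) (h₂ : TT R C X₂) (h₃ : TT R C X₃) : TT R C X₁ :=
  EE.right h.dual h₃ h₂

/-- The unit map. -/
noncomputable def eta (C : Type) [AddCommGroup C] [Module R C] (X : Type) [AddCommGroup X]
    [Module R X] : X →ₗ[R] (C →ₗ[R] C ⊗[R] X) := (TensorProduct.mk R C X).flip

@[simp] lemma eta_apply (x : X) (c : C) : eta C X x c = c ⊗ₜ[R] x := rfl

/-- The evaluation map. -/
noncomputable def eps (C : Type) [AddCommGroup C] [Module R C] (X : Type) [AddCommGroup X]
    [Module R X] : C ⊗[R] (C →ₗ[R] X) →ₗ[R] X :=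
  TensorProduct.lift (LinearMap.id (R := R) (M := C →ₗ[R] X)).flip

@[simp] lemma eps_tmul (c : C) (u : C →ₗ[R] X) : eps C X (c ⊗ₜ u) = u c := rfl

lemma eta_nat (f : X →ₗ[R] Y) : pc C (f.lTensor C) ∘ₗ eta C X = eta C Y ∘ₗ f := by
  ext x c; simp

lemma eps_nat (f : X →ₗ[R] Y) : f ∘ₗ eps C X = eps C Y ∘ₗ (pc C f).lTensor C := by
  apply TensorProduct.ext'
  intro c u; simp

/-- The Auslander class. -/
structure AA (R : Type) [CommRing R] (C X : Type) [AddCommGroup C] [Module R C]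
    [AddCommGroup X] [Module R X] : Prop where
  t : TT R C X
  bij : Function.Bijective (eta C X (R := R))
  e : EE R C (C ⊗[R] X)

/-- The Bass class. -/
structure BB (R : Type) [CommRing R] (C X : Type) [AddCommGroup C] [Module R C]
    [AddCommGroup X] [Module R X] : Prop where
  e : EE R C X
  bij : Function.Bijective (eps C X (R := R))
  t : TT R C (C →ₗ[R] X)

/-- Nonvanishing of `Hom(C, W)`. -/
def NV (R : Type) [CommRing R] (C : Type) [AddCommGroup C] [Module R C] : Prop :=
  ∀ (W : Type) [AddCommGroup W] [Module R W], (∀ u : C →ₗ[R] W, u = 0) → ∀ w : W, w = 0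

lemma NV.inj (hC : NV R C) (f : X →ₗ[R] Y) (h : Function.Injective (pc C f)) :
    Function.Injective f := by
  rw [← LinearMap.ker_eq_bot, Submodule.eq_bot_iff]
  intro x hx
  have := hC (LinearMap.ker f) (fun u => by
    have h0 : (LinearMap.ker f).subtype ∘ₗ u = 0 := h (by ext x; simp)
    ext x
    exact LinearMap.congr_fun h0 x) ⟨x, hx⟩
  exact congrArg Subtype.val this

lemma NV.surj (hC : NV R C) (f : X →ₗ[R] Y) (h : Function.Surjective (f.lTensor C)) :
    Function.Surjective f := by
  apply CharacterModule.surjective_of_dual_injective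
  apply hC.inj
  intro u v huv
  apply CharacterModule.homEquiv.injective
  apply CharacterModule.dual_injective_of_surjective _ h
  apply CharacterModule.homEquiv.symm.injective
  ext c x
  exact DFunLike.congr_fun (LinearMap.congr_fun huv c) x

lemma AA.ker (h : SES f g) (h₂ : AA R C X₂) (h₃ : AA R C X₃) : AA R C X₁ := by
  have hs := h.tensor (TT.inj h h₃.t)
  refine ⟨TT.left h h₂.t h₃.t, ?_, EE.left hs h₂.e h₃.e ?_⟩
  · exact LinearMap.bijective_of_bijective_of_injective_of_left_exact f g _ _ (eta C X₁) (eta C X₂)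
      (eta C X₃) (eta_nat f) (eta_nat g) h.exact hs.pc_exact h₂.bij h₃.bij.1 h.inj hs.pc_inj
  · have : Function.Surjective (TW.pc C (g.lTensor C) ∘ₗ eta C X₂) := by
      rw [eta_nat]
      exact h₃.bij.2.comp h.surj
    exact Function.Surjective.of_comp this

lemma AA.coker (hC : NV R C) (h : SES f g) (h₁ : AA R C X₁) (h₂ : AA R C X₂) : AA R C X₃ := by
  have hi : Function.Injective (f.lTensor C) := by
    apply hC.inj
    have : Function.Injective (TW.pc C (f.lTensor C) ∘ₗ eta C X₁) := by
      rw [eta_nat]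
      exact h₂.bij.1.comp h.inj
    exact Function.Injective.of_comp_right this h₁.bij.2
  have hs := h.tensor hi
  have hh := hs.pc (h₁.e 0)
  refine ⟨TT.right h h₁.t h₂.t hi, ?_, EE.right hs h₁.e h₂.e⟩
  exact LinearMap.bijective_of_surjective_of_bijective_of_right_exact f g _ _ (eta C X₁) (eta C X₂)
      (eta C X₃) (eta_nat f) (eta_nat g) h.exact hs.pc_exact h₁.bij.2 h₂.bij h.surj hh.surj

lemma BB.coker (h : SES f g) (h₁ : BB R C X₁) (h₂ : BB R C X₂) : BB R C X₃ := by
  have hh := h.pc (h₁.e 0)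
  have hi : Function.Injective ((TW.pc C f).lTensor C) := by
    have : Function.Injective (eps C X₂ ∘ₗ (TW.pc C f).lTensor C) := by
      rw [← eps_nat]
      exact h.inj.comp h₁.bij.1
    exact Function.Injective.of_comp this
  have hs := hh.tensor hi
  refine ⟨EE.right h h₁.e h₂.e, ?_, TT.right hh h₁.t h₂.t hi⟩
  exact LinearMap.bijective_of_surjective_of_bijective_of_right_exact _ _ f g (eps C X₁) (eps C X₂)
      (eps C X₃) (eps_nat f) (eps_nat g) hs.exact h.exact h₁.bij.2 h₂.bij hs.surj h.surj

lemma BB.ker (hC : NV R C) (h : SES f g) (h₂ : BB R C X₂) (h₃ : BB R C X₃) : BB R C X₁ := by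
  have hsu : Function.Surjective (TW.pc C g) := by
    apply hC.surj
    have : Function.Surjective (eps C X₃ ∘ₗ (TW.pc C g).lTensor C) := by
      rw [← eps_nat]
      exact h.surj.comp h₂.bij.2
    exact Function.Surjective.of_comp_left this h₃.bij.1
  have hh : SES (TW.pc C f) (TW.pc C g) := ⟨h.pc_inj, h.pc_exact, hsu⟩
  have hs := hh.tensor (TT.inj hh h₃.t)
  refine ⟨EE.left h h₂.e h₃.e hsu, ?_, TT.left hh h₂.t h₃.t⟩
  exact LinearMap.bijective_of_bijective_of_injective_of_left_exact _ _ f g (eps C X₁) (eps C X₂)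
      (eps C X₃) (eps_nat f) (eps_nat g) hs.exact h.exact h₂.bij h₃.bij.1 hs.inj h.inj

lemma EE.retract {n : ℕ} (p : Fin n → (X →ₗ[R] Y)) (s : Fin n → (Y →ₗ[R] X))
    (h : ∑ j, s j ∘ₗ p j = LinearMap.id) (hY : EE R C Y) : EE R C X :=
  fun i => XZ.retract p s h (hY i)

lemma TT.retract {n : ℕ} (p : Fin n → (X →ₗ[R] Y)) (s : Fin n → (Y →ₗ[R] X))
    (h : ∑ j, s j ∘ₗ p j = LinearMap.id) (hY : TT R C Y) : TT R C X := by
  refine EE.retract (fun j => CharacterModule.dual (s j)) (fun j => CharacterModule.dual (p j))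
    ?_ hY
  ext φ x
  have : φ (∑ j, s j (p j x)) = φ x := by
    have := LinearMap.congr_fun h x
    simp only [LinearMap.sum_apply, LinearMap.comp_apply, LinearMap.id_apply] at this
    rw [this]
  rw [map_sum] at this
  rw [LinearMap.sum_apply]
  refine Eq.trans ?_ this
  exact AddMonoidHom.finsetSum_apply (M := X) (N := AddCircle (1 : ℚ)) _ _ _

lemma bij_retract {X' Y' : Type} [AddCommGroup X'] [Module R X'] [AddCommGroup Y'] [Module R Y']
    {n : ℕ} (p : Fin n → (X →ₗ[R] Y)) (s : Fin n → (Y →ₗ[R] X))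
    (p' : Fin n → (X' →ₗ[R] Y')) (s' : Fin n → (Y' →ₗ[R] X'))
    (h : ∑ j, s j ∘ₗ p j = LinearMap.id) (h' : ∑ j, s' j ∘ₗ p' j = LinearMap.id)
    (α : X →ₗ[R] X') (β : Y →ₗ[R] Y') (hp : ∀ j, p' j ∘ₗ α = β ∘ₗ p j)
    (hs : ∀ j, s' j ∘ₗ β = α ∘ₗ s j) (hβ : Function.Bijective β) : Function.Bijective α := by
  constructor
  · rw [← LinearMap.ker_eq_bot, Submodule.eq_bot_iff]
    intro x hx
    rw [LinearMap.mem_ker] at hx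
    have := LinearMap.congr_fun h x
    simp only [LinearMap.sum_apply, LinearMap.comp_apply, LinearMap.id_apply] at this
    rw [← this]
    refine Finset.sum_eq_zero fun j _ => ?_
    have h1 : p j x = 0 := hβ.1 (by
      have := LinearMap.congr_fun (hp j) x
      simp [hx] at this
      simp [← this])
    simp [h1]
  · intro x'
    choose y hy using fun j => hβ.2 (p' j x')
    refine ⟨∑ j, s j (y j), ?_⟩
    have := LinearMap.congr_fun h' x'
    simp only [LinearMap.sum_apply, LinearMap.comp_apply, LinearMap.id_apply] at this
    rw [← this, map_sum]
    refine Finset.sum_congr rfl fun j _ => ?_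
    rw [← hy j]
    exact (LinearMap.congr_fun (hs j) (y j)).symm

lemma ltensor_retract {n : ℕ} (p : Fin n → (X →ₗ[R] Y)) (s : Fin n → (Y →ₗ[R] X))
    (h : ∑ j, s j ∘ₗ p j = LinearMap.id) :
    ∑ j, (s j).lTensor C ∘ₗ (p j).lTensor C = LinearMap.id := by
  rw [← LinearMap.lTensor_id, ← h]
  simp only [← LinearMap.lTensor_comp]
  exact (map_sum (LinearMap.lTensorHom (R := R) C) _ _).symm

lemma pc_retract {n : ℕ} (p : Fin n → (X →ₗ[R] Y)) (s : Fin n → (Y →ₗ[R] X))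
    (h : ∑ j, s j ∘ₗ p j = LinearMap.id) :
    ∑ j, pc C (s j) ∘ₗ pc C (p j) = LinearMap.id := by
  ext u c
  have := LinearMap.congr_fun h (u c)
  simp only [LinearMap.sum_apply, LinearMap.comp_apply, LinearMap.id_apply] at this
  simp [LinearMap.sum_apply, this]

lemma AA.retract {n : ℕ} (p : Fin n → (X →ₗ[R] Y)) (s : Fin n → (Y →ₗ[R] X))
    (h : ∑ j, s j ∘ₗ p j = LinearMap.id) (hY : AA R C Y) : AA R C X :=
  ⟨TT.retract p s h hY.t,
   bij_retract p s (fun j => pc C ((p j).lTensor C)) (fun j => pc C ((s j).lTensor C)) h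
     (pc_retract _ _ (ltensor_retract p s h)) _ _ (fun _ => eta_nat _) (fun _ => eta_nat _) hY.bij,
   EE.retract _ _ (ltensor_retract p s h) hY.e⟩

lemma BB.retract {n : ℕ} (p : Fin n → (X →ₗ[R] Y)) (s : Fin n → (Y →ₗ[R] X))
    (h : ∑ j, s j ∘ₗ p j = LinearMap.id) (hY : BB R C Y) : BB R C X :=
  ⟨EE.retract p s h hY.e,
   bij_retract (fun j => (pc C (p j)).lTensor C) (fun j => (pc C (s j)).lTensor C) p s
     (ltensor_retract _ _ (pc_retract p s h)) h _ _ (fun _ => eps_nat _) (fun _ => eps_nat _)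
     hY.bij,
   TT.retract _ _ (pc_retract p s h) hY.t⟩

lemma AA.of_equiv (e : X ≃ₗ[R] Y) (h : AA R C X) : AA R C Y :=
  AA.retract (n := 1) (fun _ => e.symm.toLinearMap) (fun _ => e.toLinearMap) (by simp) h

lemma BB.of_equiv (e : X ≃ₗ[R] Y) (h : BB R C X) : BB R C Y :=
  BB.retract (n := 1) (fun _ => e.symm.toLinearMap) (fun _ => e.toLinearMap) (by simp) h

lemma EE.of_equiv (e : X ≃ₗ[R] Y) (h : EE R C X) : EE R C Y :=
  EE.retract (n := 1) (fun _ => e.symm.toLinearMap) (fun _ => e.toLinearMap) (by simp) h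

lemma TT.of_equiv (e : X ≃ₗ[R] Y) (h : TT R C X) : TT R C Y :=
  TT.retract (n := 1) (fun _ => e.symm.toLinearMap) (fun _ => e.toLinearMap) (by simp) h

lemma pi_sum (n : ℕ) : ∑ j : Fin n, LinearMap.single R (fun _ : Fin n => X) j ∘ₗ
    LinearMap.proj (R := R) (φ := fun _ : Fin n => X) j = LinearMap.id := by
  apply LinearMap.ext
  intro x
  ext k
  simp [LinearMap.sum_apply, Finset.sum_apply, Pi.single_apply]

lemma AA.pow (h : AA R C X) (n : ℕ) : AA R C (Fin n → X) :=
  AA.retract _ _ (pi_sum n) h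

lemma BB.pow (h : BB R C X) (n : ℕ) : BB R C (Fin n → X) :=
  BB.retract _ _ (pi_sum n) h

lemma AA.toBB (h : AA R C X) : BB R C (C ⊗[R] X) := by
  let e : X ≃ₗ[R] (C →ₗ[R] C ⊗[R] X) := LinearEquiv.ofBijective _ h.bij
  refine ⟨h.e, ?_, TT.of_equiv e h.t⟩
  have hc : eps C (C ⊗[R] X) ∘ₗ (eta C X).lTensor C = LinearMap.id := by
    apply TensorProduct.ext'
    intro c x; simp
  have hb : Function.Bijective ((eta C X).lTensor (R := R) C) := (e.lTensor C).bijective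
  have : Function.Bijective (eps C (C ⊗[R] X) ∘ₗ (eta C X).lTensor C) := by
    rw [hc]; exact Function.bijective_id
  exact (Function.Bijective.of_comp_iff _ hb).1 this

lemma BB.toAA (h : BB R C X) : AA R C (C →ₗ[R] X) := by
  let e : (C ⊗[R] (C →ₗ[R] X)) ≃ₗ[R] X := LinearEquiv.ofBijective _ h.bij
  refine ⟨h.t, ?_, EE.of_equiv e.symm h.e⟩
  have hc : TW.pc C (eps C X) ∘ₗ eta C (C →ₗ[R] X) = LinearMap.id := by
    ext u c; simp
  have hb : Function.Bijective (TW.pc C (eps C X (R := R))) := by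
    constructor
    · intro u v huv
      ext c
      exact h.bij.1 (LinearMap.congr_fun huv c)
    · intro u
      refine ⟨e.symm.toLinearMap ∘ₗ u, ?_⟩
      ext c
      exact e.apply_symm_apply (u c)
  have : Function.Bijective (TW.pc C (eps C X) ∘ₗ eta C (C →ₗ[R] X)) := by
    rw [hc]; exact Function.bijective_id
  exact (Function.Bijective.of_comp_iff' hb _).1 this

end Classes

end TW

namespace TW

open Abelian TensorProduct

section Base

variable {R : Type} [CommRing R]

/-- Semidualizing modules, in terms of `XZ`. -/
structure SD (R : Type) [CommRing R] (C : Type) [AddCommGroup C] [Module R C] : Prop where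
  fin : Module.Finite R C
  bij : Function.Bijective (LinearMap.toSpanSingleton R (C →ₗ[R] C) LinearMap.id)
  ext : EE R C C

variable {C X Y A I : Type} [AddCommGroup C] [Module R C]
  [AddCommGroup X] [Module R X] [AddCommGroup Y] [Module R Y]
  [AddCommGroup A] [Module R A] [AddCommGroup I] [Module R I]

lemma SD.faithful (h : SD R C) {r : R} (hr : ∀ c : C, r • c = 0) : r = 0 := by
  apply h.bij.1
  ext c
  simp [hr]

lemma SD.exists_smul (h : SD R C) (u : C →ₗ[R] C) : ∃ r : R, ∀ c, u c = r • c := by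
  obtain ⟨r, hr⟩ := h.bij.2 u
  exact ⟨r, fun c => by rw [← hr]; simp⟩

lemma SD.nv [IsNoetherianRing R] (h : SD R C) : NV R C := by
  intro W _ _ hW w
  have := h.fin
  let N := Submodule.span R {w}
  have h1 : Subsingleton (C →ₗ[R] N) := by
    refine subsingleton_of_forall_eq 0 fun u => ?_
    ext c
    exact LinearMap.congr_fun (hW (N.subtype ∘ₗ u)) c
  obtain ⟨r, hr, hreg⟩ := IsSMulRegular.subsingleton_linearMap_iff.1 h1
  have hr0 : r = 0 := h.faithful (fun c => Module.mem_annihilator.1 hr c)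
  subst hr0
  have h2 : (⟨w, Submodule.mem_span_singleton_self w⟩ : N) = 0 := hreg (by simp)
  exact congrArg Subtype.val h2

lemma exists_ses [IsNoetherianRing R] (A : Type) [AddCommGroup A] [Module R A]
    [Module.Finite R A] : ∃ (n : ℕ) (g : (Fin n → R) →ₗ[R] A),
      SES (LinearMap.ker g).subtype g := by
  obtain ⟨n, g, hg⟩ := Module.Finite.exists_fin' R A
  exact ⟨n, g, Subtype.val_injective, LinearMap.exact_subtype_ker_map g, hg⟩

lemma shift [IsNoetherianRing R]
    (H : ∀ (n : ℕ) (N : Submodule R (Fin n → R)),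
      (∀ u : N →ₗ[R] X, ∃ v : (Fin n → R) →ₗ[R] X, v ∘ₗ N.subtype = u) →
      (∀ u : N →ₗ[R] Y, ∃ v : (Fin n → R) →ₗ[R] Y, v ∘ₗ N.subtype = u)) (i : ℕ) :
    ∀ (A : Type) [AddCommGroup A] [Module R A] [Module.Finite R A],
      XZ R A X (i + 1) → XZ R A Y (i + 1) := by
  induction i with
  | zero =>
    intro A _ _ _ hA
    obtain ⟨n, g, h⟩ := exists_ses (R := R) A
    exact XZ.contra_one h (XZ.of_projective 0) (H n _ (XZ.contra_surj h hA))
  | succ i ih =>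
    intro A _ _ _ hA
    obtain ⟨n, g, h⟩ := exists_ses (R := R) A
    exact XZ.contra_right h (ih _ (XZ.contra_left h (XZ.of_projective i) hA))
      (XZ.of_projective (i + 1))

lemma finsupp_hom [Module.Finite R A] {ι : Type} (u : A →ₗ[R] (ι →₀ X)) :
    ∃ s : Finset ι, u = ∑ i ∈ s, Finsupp.lsingle i ∘ₗ (Finsupp.lapply i ∘ₗ u) := by
  classical
  obtain ⟨t, ht⟩ := (Module.finite_def (R := R) (M := A)).1 inferInstance
  let s : Finset ι := t.biUnion fun a => (u a).support
  refine ⟨s, ?_⟩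
  apply LinearMap.ext_on ht
  intro a ha
  ext j
  simp only [LinearMap.sum_apply, LinearMap.comp_apply, Finsupp.lapply_apply,
    Finsupp.lsingle_apply, Finsupp.finsetSum_apply, Finsupp.single_apply]
  rw [Finset.sum_ite_eq' s j (fun i => u a i)]
  split_ifs with hj
  · rfl
  · by_contra hne
    exact hj (Finset.mem_biUnion.2 ⟨a, ha, Finsupp.mem_support_iff.2 hne⟩)

lemma EE.finsupp [IsNoetherianRing R] [Module.Finite R C] (h : EE R C X) (ι : Type) :
    EE R C (ι →₀ X) := by
  intro i
  refine shift (X := X) (Y := ι →₀ X) ?_ i C (h i)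
  intro n N hN u
  obtain ⟨s, hs⟩ := finsupp_hom u
  choose v hv using fun j => hN (Finsupp.lapply j ∘ₗ u)
  refine ⟨∑ j ∈ s, Finsupp.lsingle j ∘ₗ v j, ?_⟩
  conv_rhs => rw [hs]
  ext a
  simp only [LinearMap.comp_apply, LinearMap.sum_apply, ← hv]

lemma TT.of_flat [Module.Flat R X] : TT R C X := by
  intro i
  have : Module.Injective R (CharacterModule X) :=
    (Module.Flat.iff_characterModule_injective (R := R) (M := X)).1 inferInstance
  exact XZ.of_injective i

lemma SD.aa_finsupp [IsNoetherianRing R] (h : SD R C) (ι : Type) : AA R C (ι →₀ R) := by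
  classical
  have := h.fin
  let e : (C ⊗[R] (ι →₀ R)) ≃ₗ[R] (ι →₀ C) := TensorProduct.finsuppScalarRight R R C ι
  have he : ∀ c (x : ι →₀ R) i, e (c ⊗ₜ x) i = x i • c := fun c x i => by
    simp [e, TensorProduct.finsuppScalarRight_apply_tmul_apply]
  refine ⟨TT.of_flat, ⟨?_, ?_⟩, EE.of_equiv e.symm (h.ext.finsupp ι)⟩
  · rw [← LinearMap.ker_eq_bot, Submodule.eq_bot_iff]
    intro x hx
    ext i
    apply h.faithful
    intro c
    rw [← he, ← eta_apply, LinearMap.mem_ker.1 hx]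
    simp
  · intro u
    obtain ⟨s, hs⟩ := finsupp_hom (e.toLinearMap ∘ₗ u)
    choose r hr using fun j => h.exists_smul (Finsupp.lapply j ∘ₗ (e.toLinearMap ∘ₗ u))
    refine ⟨∑ j ∈ s, Finsupp.single j (r j), ?_⟩
    ext c
    apply e.injective
    have h1 := LinearMap.congr_fun hs c
    refine Eq.trans ?_ h1.symm
    ext k
    rw [eta_apply, he]
    simp only [LinearMap.sum_apply, LinearMap.comp_apply (f := Finsupp.lsingle _), hr,
      Finsupp.lsingle_apply, Finsupp.finsetSum_apply, Finsupp.single_apply, Finset.sum_smul]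
    refine Finset.sum_congr rfl fun j _ => ?_
    split_ifs with hj <;> simp

lemma SD.aa_projective [IsNoetherianRing R] (h : SD R C) [Module.Projective R X] : AA R C X := by
  obtain ⟨s, hs⟩ := (Module.projective_def' (R := R) (P := X)).1 inferInstance
  exact AA.retract (n := 1) (fun _ => s) (fun _ => Finsupp.linearCombination R id) (by simpa using hs)
    (h.aa_finsupp X)

/-- The natural map `A ⊗ Hom(C, I) → Hom(Hom(A, C), I)`. -/
noncomputable def theta (C I A : Type) [AddCommGroup C] [Module R C]
    [AddCommGroup A] [Module R A] [AddCommGroup I] [Module R I] :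
    A ⊗[R] (C →ₗ[R] I) →ₗ[R] ((A →ₗ[R] C) →ₗ[R] I) :=
  TensorProduct.lift (LinearMap.mk₂ R (fun a φ => φ ∘ₗ LinearMap.applyₗ a)
    (fun a b φ => by ext; simp) (fun r a φ => by ext; simp) (fun a φ ψ => by ext; simp)
    (fun r a φ => by ext; simp))

@[simp] lemma theta_tmul (a : A) (φ : C →ₗ[R] I) (u : A →ₗ[R] C) :
    theta C I A (a ⊗ₜ φ) u = φ (u a) := rfl

/-- The double pre-composition. -/
noncomputable def dd (C I : Type) [AddCommGroup C] [Module R C] [AddCommGroup I] [Module R I]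
    (f : X →ₗ[R] Y) : ((X →ₗ[R] C) →ₗ[R] I) →ₗ[R] ((Y →ₗ[R] C) →ₗ[R] I) :=
  LinearMap.lcomp R I (LinearMap.lcomp R C f)

lemma theta_nat (f : X →ₗ[R] Y) :
    dd C I f ∘ₗ theta C I X = theta C I Y ∘ₗ f.rTensor (C →ₗ[R] I) := by
  apply TensorProduct.ext'
  intro x φ
  ext u
  simp [dd]

lemma lcomp_exact {U V W : Type} [AddCommGroup U] [Module R U] [AddCommGroup V] [Module R V]
    [AddCommGroup W] [Module R W] [Module.Injective R I] (α : U →ₗ[R] V) (β : V →ₗ[R] W)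
    (h : Function.Exact α β) : Function.Exact (LinearMap.lcomp R I β) (LinearMap.lcomp R I α) := by
  intro φ
  constructor
  · intro hφ
    have hk : LinearMap.ker β ≤ LinearMap.ker φ := by
      intro x hx
      obtain ⟨y, rfl⟩ := (h x).1 hx
      exact LinearMap.congr_fun hφ y
    have hi : Function.Injective ((LinearMap.ker β).liftQ β le_rfl) := by
      rw [← LinearMap.ker_eq_bot]
      exact Submodule.ker_liftQ_eq_bot _ _ _ le_rfl
    obtain ⟨ψ, hψ⟩ := Module.Injective.out _ hi ((LinearMap.ker β).liftQ φ hk)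
    refine ⟨ψ, ?_⟩
    ext x
    have := hψ (Submodule.Quotient.mk x)
    simpa using this
  · rintro ⟨ψ, rfl⟩
    ext x
    simp [h.apply_apply_eq_zero]

lemma lcomp_surj {V W : Type} [AddCommGroup V] [Module R V]
    [AddCommGroup W] [Module R W] [Module.Injective R I] (β : V →ₗ[R] W)
    (h : Function.Injective β) : Function.Surjective (LinearMap.lcomp R I β) := by
  intro φ
  obtain ⟨ψ, hψ⟩ := Module.Injective.out β h φ
  exact ⟨ψ, by ext x; simpa using hψ x⟩

lemma theta_ring : Function.Bijective (theta C I R (R := R)) := by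
  let e : (R →ₗ[R] C) ≃ₗ[R] C := LinearMap.ringLmapEquivSelf R R C
  let e' : ((R →ₗ[R] C) →ₗ[R] I) ≃ₗ[R] (C →ₗ[R] I) := LinearEquiv.congrLeft I R e
  have : theta C I R = ((TensorProduct.lid R (C →ₗ[R] I)).trans e'.symm).toLinearMap := by
    apply TensorProduct.ext'
    intro r φ
    ext u
    have : u r = r • u 1 := by rw [← map_smul, smul_eq_mul, mul_one]
    simp [e', e, LinearEquiv.congrLeft, this]
  rw [this]
  exact LinearEquiv.bijective _

lemma theta_free (n : ℕ) : Function.Bijective (theta C I (Fin n → R) (R := R)) := by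
  refine bij_retract (fun j => (LinearMap.proj (R := R) (φ := fun _ : Fin n => R) j).rTensor _)
    (fun j => (LinearMap.single R (fun _ : Fin n => R) j).rTensor _)
    (fun j => dd C I (LinearMap.proj (R := R) (φ := fun _ : Fin n => R) j))
    (fun j => dd C I (LinearMap.single R (fun _ : Fin n => R) j)) ?_ ?_ _ (theta C I R)
    (fun _ => theta_nat _) (fun _ => theta_nat _) theta_ring
  · rw [← LinearMap.rTensor_id, ← pi_sum]
    simp only [← LinearMap.rTensor_comp]
    exact (map_sum (LinearMap.rTensorHom (R := R) (C →ₗ[R] I)) _ _).symm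
  · ext φ u
    simp only [LinearMap.sum_apply, LinearMap.comp_apply, dd, LinearMap.lcomp_apply',
      LinearMap.id_apply]
    rw [← map_sum]
    congr 1
    ext x
    have := LinearMap.congr_fun (pi_sum (R := R) (X := R) n) (Pi.single x 1)
    have h2 := congrArg u this
    simpa [LinearMap.sum_apply, map_sum] using h2

lemma dd_exact [Module.Injective R I] {X₁ X₂ X₃ : Type} [AddCommGroup X₁] [Module R X₁]
    [AddCommGroup X₂] [Module R X₂] [AddCommGroup X₃] [Module R X₃]
    {f : X₁ →ₗ[R] X₂} {g : X₂ →ₗ[R] X₃} (h : SES f g) :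
    Function.Exact (dd C I f) (dd C I g) ∧ Function.Surjective (dd C I g) := by
  constructor
  · apply lcomp_exact
    exact LinearMap.exact_lcomp_of_exact_of_surjective _ h.exact h.surj
  · apply lcomp_surj
    intro u v huv
    ext x
    obtain ⟨y, rfl⟩ := h.surj x
    exact LinearMap.congr_fun huv y

lemma theta_surj [IsNoetherianRing R] [Module.Injective R I] [Module.Finite R A] :
    Function.Surjective (theta C I A (R := R)) := by
  obtain ⟨n, g, h⟩ := exists_ses (R := R) A
  have : Function.Surjective (dd C I g ∘ₗ theta C I (Fin n → R)) :=
    (dd_exact h).2.comp (theta_free n).2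
  rw [theta_nat] at this
  exact Function.Surjective.of_comp this

lemma theta_bij [IsNoetherianRing R] [Module.Injective R I] [Module.Finite R A] :
    Function.Bijective (theta C I A (R := R)) := by
  obtain ⟨n, g, h⟩ := exists_ses (R := R) A
  exact LinearMap.bijective_of_surjective_of_bijective_of_right_exact _ _ _ _ _ _ _
    (theta_nat _) (theta_nat _) (rTensor_exact _ h.exact h.surj) (dd_exact h).1 theta_surj
    (theta_free n) (LinearMap.rTensor_surjective _ h.surj) (dd_exact h).2

lemma SD.bb_injective [IsNoetherianRing R] (h : SD R C) [Module.Injective R I] : BB R C I := by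
  have := h.fin
  refine ⟨fun i => XZ.of_injective i, ?_, fun i => ?_⟩
  · let ev : ((C →ₗ[R] C) →ₗ[R] I) →ₗ[R] I := LinearMap.applyₗ LinearMap.id
    have h1 : eps C I = ev ∘ₗ theta C I C := by
      apply TensorProduct.ext'
      intro c φ
      simp [ev]
    have h2 : Function.Bijective ev := by
      let e : R ≃ₗ[R] (C →ₗ[R] C) := LinearEquiv.ofBijective _ h.bij
      have he : ∀ r, e r = r • LinearMap.id := fun r => rfl
      constructor
      · intro φ ψ hφ
        ext u
        obtain ⟨r, rfl⟩ := e.surjective u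
        have hφ' : φ LinearMap.id = ψ LinearMap.id := hφ
        simp [he, hφ']
      · intro x
        refine ⟨LinearMap.toSpanSingleton R I x ∘ₗ e.symm.toLinearMap, ?_⟩
        have : e.symm LinearMap.id = 1 := by
          rw [LinearEquiv.symm_apply_eq, he, one_smul]
        simp [ev, this]
    rw [h1]
    exact h2.comp theta_bij
  · refine shift (X := C) ?_ i C (h.ext i)
    intro n N hN
    have h1 : Function.Injective (dd C I N.subtype) := by
      intro φ ψ hφ
      ext u
      obtain ⟨v, rfl⟩ := hN u
      exact LinearMap.congr_fun hφ v
    have h2 : Function.Injective (N.subtype.rTensor (C →ₗ[R] I)) := by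
      have : Function.Injective (theta C I (Fin n → R) ∘ₗ N.subtype.rTensor (C →ₗ[R] I)) := by
        rw [← theta_nat]
        exact h1.comp theta_bij.1
      exact Function.Injective.of_comp this
    intro u
    exact rTensor_injective_iff_lcomp_surjective.1 h2 u

end Base

end TW

namespace TW

open Abelian TensorProduct

section Main

variable {R : Type} [CommRing R] [IsLocalRing R]

lemma ext_residue_smul {X Y : Type} [AddCommGroup X] [Module R X] [AddCommGroup Y] [Module R Y]
    {r : R} (hr : ∀ x : X, r • x = 0) {i : ℕ}
    (e : Ext (ModuleCat.of R X) (ModuleCat.of R Y) i) : r • e = 0 := by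
  have h0 : r • 𝟙 (ModuleCat.of R X) = 0 := by
    ext x
    exact hr x
  have : r • e = (Ext.mk₀ (r • 𝟙 (ModuleCat.of R X))).comp e (zero_add i) := by
    simp [Ext.mk₀_smul]
  rw [this, h0]
  simp

lemma residue_smul {r : R} (hr : r ∈ IsLocalRing.maximalIdeal R)
    (x : IsLocalRing.ResidueField R) : r • x = 0 := by
  obtain ⟨s, rfl⟩ := IsLocalRing.residue_surjective x
  have : r • IsLocalRing.residue R s = IsLocalRing.residue R (r * s) := by
    rw [map_mul]
    rfl
  rw [this, IsLocalRing.residue_eq_zero_iff]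
  exact Ideal.mul_mem_right _ _ hr

/-- No socle. -/
def NoSoc (R : Type) [CommRing R] [IsLocalRing R] (M : Type) [AddCommGroup M] [Module R M] :
    Prop := ∀ y : M, (∀ r ∈ IsLocalRing.maximalIdeal R, r • y = 0) → y = 0

variable {C : Type} [AddCommGroup C] [Module R C] 

lemma depth_infinite [IsNoetherianRing R] (hC : SD R C)
    (H : ∀ (M : Type) [AddCommGroup M] [Module R M], AA R C M → BB R C M → NoSoc R M) (i : ℕ) :
    ∀ (M : Type) [AddCommGroup M] [Module R M], AA R C M → BB R C M →
      XZ R (IsLocalRing.ResidueField R) M i := by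
  induction i with
  | zero =>
    intro M _ _ hA hB
    refine subsingleton_of_forall_eq 0 fun x => ?_
    obtain ⟨u, rfl⟩ := (Ext.mk₀_bijective _ _).2 x
    have : u = 0 := by
      ext x
      apply H M hA hB
      intro r hr
      rw [← map_smul]
      have : r • x = 0 := residue_smul hr x
      rw [this]
      simp
    rw [this]
    simp
  | succ i ih =>
    intro M _ _ hA hB
    obtain ⟨a, x, hx⟩ := Submodule.fg_iff_exists_fin_generating_family.1
      (IsNoetherian.noetherian (IsLocalRing.maximalIdeal R))
    let f : M →ₗ[R] (Fin a → M) := LinearMap.pi fun j => x j • LinearMap.id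
    have hf : Function.Injective f := by
      rw [← LinearMap.ker_eq_bot, Submodule.eq_bot_iff]
      intro y hy
      apply H M hA hB y
      intro r hr
      rw [← hx] at hr
      refine Submodule.span_induction (p := fun r _ => r • y = 0) ?_ (by simp) ?_ ?_ hr
      · rintro _ ⟨j, rfl⟩
        exact congrFun hy j
      · intro r s _ _ h1 h2
        rw [add_smul, h1, h2, add_zero]
      · intro r s _ h1
        rw [smul_assoc, h1, smul_zero]
    have hs : SES f (LinearMap.range f).mkQ :=
      ⟨hf, LinearMap.exact_map_mkQ_range f, Submodule.mkQ_surjective _⟩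
    refine XZ.left_of_zero hs ?_ (ih _ (AA.coker hC.nv hs hA (hA.pow a))
      (BB.coker hs hB (hB.pow a)))
    intro e
    have h1 : ModuleCat.ofHom f =
        ∑ j, x j • ModuleCat.ofHom (LinearMap.single R (fun _ : Fin a => M) j) := by
      apply ModuleCat.hom_ext
      rw [ModuleCat.hom_sum]
      apply LinearMap.ext
      intro y
      ext k
      simp [f, LinearMap.sum_apply, Finset.sum_apply, Pi.single_apply]
    rw [h1, Ext.mk₀_sum, Ext.comp_sum]
    refine Finset.sum_eq_zero fun j _ => ?_
    rw [Ext.mk₀_smul, Ext.comp_smul]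
    apply ext_residue_smul
    intro z
    apply residue_smul
    rw [← hx]
    exact Submodule.subset_span ⟨j, rfl⟩

lemma exists_functional [Module.Finite R C] (N : Submodule R C) (hN : N ≠ ⊤) :
    ∃ α : C →ₗ[R] (R ⧸ IsLocalRing.maximalIdeal R), Function.Surjective α ∧ ∀ c ∈ N, α c = 0 := by
  obtain ⟨N', hc, hle⟩ := (eq_top_or_exists_le_coatom N).resolve_left hN
  have : IsSimpleModule R (C ⧸ N') := isSimpleModule_iff_isCoatom.2 hc
  obtain ⟨J, hJ, ⟨e⟩⟩ := isSimpleModule_iff_quot_maximal.1 this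
  have hJ' : J = IsLocalRing.maximalIdeal R := IsLocalRing.eq_maximalIdeal hJ
  subst hJ'
  refine ⟨e.toLinearMap ∘ₗ N'.mkQ, e.surjective.comp (Submodule.mkQ_surjective _), fun c h => ?_⟩
  have : N'.mkQ c = 0 := by simpa using hle h
  rw [LinearMap.comp_apply, this, map_zero]

lemma equiv_of_socle (hC : SD R C) {M : Type} [AddCommGroup M] [Module R M] (hA : AA R C M)
    (hB : BB R C M) (hM : ¬ NoSoc R M) : Nonempty (C ≃ₗ[R] R) := by
  have := hC.fin
  unfold NoSoc at hM
  push Not at hM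
  obtain ⟨y, hy, hy0⟩ := hM
  obtain ⟨x₀, hx₀⟩ : ∃ x₀ : C, x₀ ⊗ₜ[R] y ≠ 0 := by
    by_contra! h
    exact hy0 (hA.bij.1 (by ext c; simp [h]))
  set y' := x₀ ⊗ₜ[R] y with hy'
  have hmy : ∀ r ∈ IsLocalRing.maximalIdeal R, r • y' = 0 := fun r hr => by
    rw [hy', ← TensorProduct.tmul_smul, hy r hr, TensorProduct.tmul_zero]
  let σ : (R ⧸ IsLocalRing.maximalIdeal R) →ₗ[R] C ⊗[R] M :=
    (IsLocalRing.maximalIdeal R).liftQ (LinearMap.toSpanSingleton R _ y') (fun r hr => hmy r hr)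
  have hσ : ∀ t, σ t = 0 → t = 0 := by
    intro t ht
    obtain ⟨r, rfl⟩ := Submodule.Quotient.mk_surjective _ t
    have h1 : r • y' = 0 := ht
    rw [Submodule.Quotient.mk_eq_zero]
    by_contra hr
    rw [IsLocalRing.mem_maximalIdeal, mem_nonunits_iff, not_not] at hr
    exact hx₀ ((IsUnit.smul_eq_zero hr).1 h1)
  have hbot : (⊥ : Submodule R C) ≠ ⊤ := by
    intro h
    have : (1 : R) = 0 := hC.faithful fun c => by
      have : c ∈ (⊥ : Submodule R C) := by rw [h]; trivial
      simp [(Submodule.mem_bot R).1 this]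
    exact one_ne_zero this
  obtain ⟨β, hβ, -⟩ := exists_functional (⊥ : Submodule R C) hbot
  obtain ⟨c, hc⟩ := hβ 1
  have htop : Submodule.span R {c} = ⊤ := by
    by_contra hne
    obtain ⟨α, hα, hαc⟩ := exists_functional _ hne
    replace hαc := hαc c (Submodule.mem_span_singleton_self c)
    let b : C →ₗ[R] C →ₗ[R] C ⊗[R] M :=
      ((LinearMap.mul R (R ⧸ IsLocalRing.maximalIdeal R)).compl₁₂ α β).compr₂ σ
    have hb : ∀ x z, b x z = σ (α x * β z) := fun x z => rfl
    let e : M ≃ₗ[R] (C →ₗ[R] C ⊗[R] M) := LinearEquiv.ofBijective _ hA.bij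
    let ψ : C →ₗ[R] M := e.symm.toLinearMap ∘ₗ b
    have hψ : ∀ x, eta C M (ψ x) = b x := fun x => e.apply_symm_apply (b x)
    have h1 : c ⊗ₜ[R] ψ = 0 := by
      apply hB.bij.1
      rw [eps_tmul, map_zero]
      apply hA.bij.1
      rw [hψ, map_zero]
      ext z
      rw [hb, hαc, zero_mul, map_zero, LinearMap.zero_apply]
    let Λ : C ⊗[R] (C →ₗ[R] M) →ₗ[R] (C →ₗ[R] C ⊗[R] M) :=
      TensorProduct.lift (LinearMap.mk₂ R (fun c ψ => (eta C M ∘ₗ ψ).flip c)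
        (fun a b φ => by ext; simp [TensorProduct.add_tmul])
        (fun r a φ => by ext; simp [TensorProduct.smul_tmul])
        (fun a φ ψ => by ext; simp [TensorProduct.tmul_add])
        (fun r a φ => by ext; simp))
    have hΛ : ∀ x, Λ (c ⊗ₜ ψ) x = eta C M (ψ x) c := fun x => rfl
    obtain ⟨x, hx⟩ := hα 1
    have h2 := hΛ x
    rw [h1, hψ, hb, hx, hc, mul_one, map_zero, LinearMap.zero_apply] at h2
    have h3 := hσ 1 h2.symm
    exact one_ne_zero h3
  let φ : R →ₗ[R] C := LinearMap.toSpanSingleton R C c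
  have hsur : Function.Surjective φ := by
    rw [← LinearMap.range_eq_top, LinearMap.range_toSpanSingleton, htop]
  have hinj : Function.Injective φ := by
    rw [← LinearMap.ker_eq_bot, Submodule.eq_bot_iff]
    intro r hr
    apply hC.faithful
    intro d
    obtain ⟨s, rfl⟩ := hsur d
    rw [← map_smul, smul_eq_mul, mul_comm, ← smul_eq_mul, map_smul, LinearMap.mem_ker.1 hr,
      smul_zero]
  exact ⟨(LinearEquiv.ofBijective φ ⟨hinj, hsur⟩).symm⟩

theorem equiv_ring [IsNoetherianRing R] (hC : SD R C) {M : Type} [AddCommGroup M] [Module R M]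
    (hA : AA R C M) (hB : BB R C M) {i : ℕ} (hM : ¬ XZ R (IsLocalRing.ResidueField R) M i) :
    Nonempty (C ≃ₗ[R] R) := by
  by_contra hne
  apply hM
  refine depth_infinite hC ?_ i M hA hB
  intro M' _ _ hA' hB'
  by_contra h
  exact hne (equiv_of_socle hC hA' hB' h)

end Main

end TW

namespace TW

open Abelian TensorProduct

section Compare

variable {R : Type} [CommRing R]

lemma subsingleton_oldExt_iff (X Y : ModuleCat.{0} R) (n : ℕ) :
    Subsingleton (((_root_.Ext R (ModuleCat.{0} R) n).obj (Opposite.op X)).obj Y) ↔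
      Subsingleton (Abelian.Ext X Y n) := by
  let P := projectiveResolution X
  have h1 : Subsingleton (((_root_.Ext R (ModuleCat.{0} R) n).obj (Opposite.op X)).obj Y) ↔
      (P.complex.linearYonedaObj R Y).ExactAt n := by
    rw [HomologicalComplex.exactAt_iff_isZero_homology, ← ModuleCat.isZero_iff_subsingleton]
    exact (P.isoExt (R := R) n Y).isZero_iff
  rw [h1]
  cases n with
  | zero =>
    rw [(P.complex.linearYonedaObj R Y).exactAt_iff' 0 0 1 (by simp) (by simp),
      ShortComplex.moduleCat_exact_iff]
    have e : (X ⟶ Y) ≃ Abelian.Ext X Y 0 := Equiv.ofBijective _ (Ext.mk₀_bijective X Y)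
    rw [← e.subsingleton_congr]
    let q : P.complex.X 0 ⟶ X := P.π.f 0
    have hq : P.complex.d 1 0 ≫ q = 0 := P.complex_d_comp_π_f_zero
    have hepi : Epi q := inferInstanceAs (Epi (P.π.f 0))
    have hqe : (ShortComplex.mk (P.complex.d 1 0) q hq).Exact := P.exact₀
    constructor
    · intro h
      refine subsingleton_of_forall_eq 0 fun g => ?_
      obtain ⟨y, hy⟩ := h (q ≫ g) (by
        change P.complex.d 1 0 ≫ q ≫ g = 0
        rw [reassoc_of% hq, zero_comp])
      have hy' : P.complex.d 0 0 ≫ (show P.complex.X 0 ⟶ Y from y) = q ≫ g := hy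
      rw [P.complex.shape 0 0 (by simp), zero_comp] at hy'
      rw [← cancel_epi q, ← hy', comp_zero]
    · intro h x hx
      refine ⟨0, ?_⟩
      rw [map_zero]
      symm
      let x' : P.complex.X 0 ⟶ Y := x
      have hx' : P.complex.d 1 0 ≫ x' = 0 := hx
      have h0 : hqe.desc x' hx' = 0 := Subsingleton.elim (α := (X ⟶ Y)) _ _
      have := hqe.g_desc x' hx'
      rw [h0, comp_zero] at this
      exact this.symm
  | succ p =>
    rw [(P.complex.linearYonedaObj R Y).exactAt_iff' p (p+1) (p+2) (by simp) (by simp),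
      ShortComplex.moduleCat_exact_iff]
    constructor
    · intro h
      refine subsingleton_of_forall_eq 0 fun α => ?_
      obtain ⟨f, hf, rfl⟩ := P.extMk_surjective α (p+2) rfl
      rw [P.extMk_eq_zero_iff _ _ _ _ p rfl]
      obtain ⟨g, hg⟩ := h f hf
      exact ⟨g, hg⟩
    · intro h x hx
      obtain ⟨g, hg⟩ := (P.extMk_eq_zero_iff (x : P.complex.X (p+1) ⟶ Y) (p+2) rfl hx p rfl).1
        (Subsingleton.elim _ _)
      exact ⟨g, hg⟩

end Compare

section Resolutions

variable {R : Type} [CommRing R]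

/-- The cokernel of the differential into degree `k`. -/
abbrev NQ (G : ChainComplex (ModuleCat.{0} R) ℕ) (k : ℕ) : Type :=
  (G.X k) ⧸ LinearMap.range (G.d (k+1) k).hom

/-- The kernel of the differential out of degree `k`. -/
abbrev KK (J : CochainComplex (ModuleCat.{0} R) ℕ) (k : ℕ) : Type :=
  LinearMap.ker (J.d k (k+1)).hom

lemma nq_ses (G : ChainComplex (ModuleCat.{0} R) ℕ) (k : ℕ) (h : G.ExactAt (k+1)) :
    ∃ (f : NQ G (k+1) →ₗ[R] G.X k) (g : G.X k →ₗ[R] NQ G k), SES f g := by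
  rw [G.exactAt_iff' (k+2) (k+1) k (by simp) (by simp),
      ShortComplex.moduleCat_exact_iff] at h
  refine ⟨Submodule.liftQ _ (G.d (k+1) k).hom ?_, Submodule.mkQ _, ?_, ?_, ?_⟩
  · rintro _ ⟨x, rfl⟩
    exact ConcreteCategory.congr_hom (G.d_comp_d (k+2) (k+1) k) x
  · rw [← LinearMap.ker_eq_bot, Submodule.ker_liftQ_eq_bot']
    refine le_antisymm ?_ ?_
    · rintro _ ⟨x, rfl⟩
      exact ConcreteCategory.congr_hom (G.d_comp_d (k+2) (k+1) k) x
    · intro x hx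
      obtain ⟨y, hy⟩ := h x hx
      exact ⟨y, hy⟩
  · rw [LinearMap.exact_iff, Submodule.ker_mkQ, Submodule.range_liftQ]
  · exact Submodule.mkQ_surjective _

lemma kk_ses (J : CochainComplex (ModuleCat.{0} R) ℕ) (k : ℕ) (h : J.ExactAt (k+1)) :
    ∃ (f : KK J k →ₗ[R] J.X k) (g : J.X k →ₗ[R] KK J (k+1)), SES f g := by
  rw [J.exactAt_iff' k (k+1) (k+2) (by simp) (by simp),
      ShortComplex.moduleCat_exact_iff] at h
  refine ⟨Submodule.subtype _, LinearMap.codRestrict _ (J.d k (k+1)).hom ?_, ?_, ?_, ?_⟩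
  · intro x
    exact ConcreteCategory.congr_hom (J.d_comp_d k (k+1) (k+2)) x
  · exact Submodule.subtype_injective _
  · intro x
    constructor
    · intro hx
      exact ⟨⟨x, congrArg Subtype.val hx⟩, rfl⟩
    · rintro ⟨y, rfl⟩
      exact Subtype.ext y.2
  · rintro ⟨x, hx⟩
    obtain ⟨y, hy⟩ := h x hx
    exact ⟨y, Subtype.ext hy⟩

theorem of_resolution (Pr : ∀ (X : Type) [AddCommGroup X] [Module R X], Prop)
    (hiso : ∀ (X Y : Type) [AddCommGroup X] [Module R X] [AddCommGroup Y] [Module R Y],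
      (X ≃ₗ[R] Y) → Pr X → Pr Y)
    (hcok : ∀ (X Y Z : Type) [AddCommGroup X] [Module R X] [AddCommGroup Y] [Module R Y]
      [AddCommGroup Z] [Module R Z] (f : X →ₗ[R] Y) (g : Y →ₗ[R] Z), SES f g →
      Pr X → Pr Y → Pr Z)
    (M : Type) [AddCommGroup M] [Module R M] (n : ℕ)
    (G : ChainComplex (ModuleCat.{0} R) ℕ)
    (f : G ⟶ (HomologicalComplex.single (ModuleCat.{0} R) (ComplexShape.down ℕ) 0).obj
        (ModuleCat.of R M)) (hf : QuasiIso f) (hG : ∀ i, Pr (G.X i))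
    (hn : ∀ i, n < i → IsZero (G.X i)) : Pr M := by
  have hex : ∀ k, G.ExactAt (k+1) := fun k =>
    (exactAt_iff_of_quasiIsoAt f (k+1)).2 (HomologicalComplex.exactAt_single_obj _ _ _ _ (by simp))
  have key : ∀ j k, n + 1 ≤ k + j → Pr (NQ G k) := by
    intro j
    induction j with
    | zero =>
      intro k hk
      have hz := hn k (by omega)
      have : Subsingleton (G.X k) := ModuleCat.isZero_iff_subsingleton.1 hz
      exact hiso _ _ (LinearEquiv.ofBijective (Submodule.mkQ _)
        ⟨Function.injective_of_subsingleton _, Submodule.mkQ_surjective _⟩) (hG k)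
    | succ j ih =>
      intro k hk
      obtain ⟨f, g, h⟩ := nq_ses G k (hex k)
      exact hcok _ _ _ f g h (ih (k+1) (by omega)) (hG k)
  have h0 := key (n+1) 0 (by omega)
  have e1 : G.homology 0 ≅ ModuleCat.of R M :=
    asIso (HomologicalComplex.homologyMap f 0) ≪≫
      HomologicalComplex.singleObjHomologySelfIso (ComplexShape.down ℕ) 0 _
  have e2 : G.homology 0 ≅ G.opcycles 0 := G.isoHomologyι₀
  have e3 := (G.sc 0).moduleCatOpcyclesIso
  have e4 : NQ G 0 ≃ₗ[R] ((G.sc 0).X₂ ⧸ LinearMap.range (G.sc 0).f.hom) :=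
    Submodule.quotEquivOfEq _ _ (by
      change _ = LinearMap.range (G.d ((ComplexShape.down ℕ).prev 0) 0).hom
      rw [show (ComplexShape.down ℕ).prev 0 = 0 + 1 by simp])
  exact hiso _ _ (e4.trans ((e3.symm ≪≫ e2.symm ≪≫ e1).toLinearEquiv)) h0

theorem of_coresolution (Pr : ∀ (X : Type) [AddCommGroup X] [Module R X], Prop)
    (hiso : ∀ (X Y : Type) [AddCommGroup X] [Module R X] [AddCommGroup Y] [Module R Y],
      (X ≃ₗ[R] Y) → Pr X → Pr Y)
    (hker : ∀ (X Y Z : Type) [AddCommGroup X] [Module R X] [AddCommGroup Y] [Module R Y]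
      [AddCommGroup Z] [Module R Z] (f : X →ₗ[R] Y) (g : Y →ₗ[R] Z), SES f g →
      Pr Y → Pr Z → Pr X)
    (M : Type) [AddCommGroup M] [Module R M] (n : ℕ)
    (J : CochainComplex (ModuleCat.{0} R) ℕ)
    (f : (HomologicalComplex.single (ModuleCat.{0} R) (ComplexShape.up ℕ) 0).obj
        (ModuleCat.of R M) ⟶ J) (hf : QuasiIso f) (hJ : ∀ i, Pr (J.X i))
    (hn : ∀ i, n < i → IsZero (J.X i)) : Pr M := by
  have hex : ∀ k, J.ExactAt (k+1) := fun k =>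
    (exactAt_iff_of_quasiIsoAt f (k+1)).1 (HomologicalComplex.exactAt_single_obj _ _ _ _ (by simp))
  have key : ∀ j k, n + 1 ≤ k + j → Pr (KK J k) := by
    intro j
    induction j with
    | zero =>
      intro k hk
      have hz := hn k (by omega)
      have : Subsingleton (J.X k) := ModuleCat.isZero_iff_subsingleton.1 hz
      exact hiso _ _ (LinearEquiv.ofBijective (Submodule.subtype _)
        ⟨Submodule.subtype_injective _, fun x => ⟨0, Subsingleton.elim _ _⟩⟩).symm (hJ k)
    | succ j ih =>
      intro k hk
      obtain ⟨f, g, h⟩ := kk_ses J k (hex k)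
      exact hker _ _ _ f g h (hJ k) (ih (k+1) (by omega))
  have h0 := key (n+1) 0 (by omega)
  have e1 : ModuleCat.of R M ≅ J.homology 0 :=
    (HomologicalComplex.singleObjHomologySelfIso (ComplexShape.up ℕ) 0 _).symm ≪≫
      asIso (HomologicalComplex.homologyMap f 0)
  have e2 : J.cycles 0 ≅ J.homology 0 := J.isoHomologyπ₀
  have e3 := (J.sc 0).moduleCatCyclesIso
  have e4 : KK J 0 ≃ₗ[R] (LinearMap.ker (J.sc 0).g.hom) :=
    LinearEquiv.ofEq _ _ (by
      change _ = LinearMap.ker (J.d 0 ((ComplexShape.up ℕ).next 0)).hom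
      rw [show (ComplexShape.up ℕ).next 0 = 0 + 1 by simp])
  exact hiso _ _ (e4.trans ((e3.symm ≪≫ e2 ≪≫ e1.symm).toLinearEquiv)) h0

end Resolutions

end TW

/-- the question of Takahashi and White, answered
affirmatively.  Let `(R, m, k)` be a commutative noetherian local
Cohen–Macaulay ring (`depth R = dim R`, where
`depth_R(M) = inf {i | Ext^i_R(k, M) ≠ 0}`) admitting a dualizing module
(a semidualizing module of finite injective dimension), and let `C` be a
semidualizing `R`-module.  If there is an `R`-module `M` of finite depth with
`P_C-pd_R(M) < ∞` and `I_C-id_R(M) < ∞`, then `R` is Gorenstein (i.e. `R` has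
finite injective dimension as a module over itself). -/
theorem takahashi_white_question
    (R : Type) [CommRing R] [IsNoetherianRing R] [IsLocalRing R]
    (hCM : ((sInf {i : ℕ |
        Nontrivial (extGroup R i (IsLocalRing.ResidueField R) R)} : ℕ) :
          WithBot (WithTop ℕ)) = ringKrullDim R)
    (hdual : ∃ (D : Type) (_ : AddCommGroup D) (_ : Module R D),
        IsSemidualizingModule R D ∧ ∃ n : ℕ, ModuleInjDimLE R D n)
    (C : Type) [AddCommGroup C] [Module R C] (hC : IsSemidualizingModule R C)
    (M : Type) [AddCommGroup M] [Module R M]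
    (hdepth : ∃ i : ℕ, Nontrivial (extGroup R i (IsLocalRing.ResidueField R) M))
    (hpd : ∃ n : ℕ, PCpdLE R C M n) (hid : ∃ n : ℕ, ICidLE R C M n) :
    ∃ n : ℕ, ModuleInjDimLE R R n := by
  have toSD : ∀ (E : Type) [AddCommGroup E] [Module R E], IsSemidualizingModule R E →
      TW.SD R E := fun E _ _ h => ⟨h.1, h.2.1, fun i =>
    (TW.subsingleton_oldExt_iff _ _ _).1 (h.2.2 (i + 1) (by omega))⟩
  have hCs := toSD C hC
  obtain ⟨D, _, _, hD, m, J₀, f₀, hf₀, hJ₀, hz₀⟩ := hdual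
  have hDs := toSD D hD
  obtain ⟨i, hi⟩ := hdepth
  have hM : ¬ TW.XZ R (IsLocalRing.ResidueField R) M i := fun h =>
    not_subsingleton_iff_nontrivial.2 hi ((TW.subsingleton_oldExt_iff _ _ _).2 h)
  obtain ⟨n₁, G, f₁, hf₁, hG, hz₁⟩ := hpd
  obtain ⟨n₂, J, f₂, hf₂, hJ, hz₂⟩ := hid
  have hMB : TW.BB R C M := by
    refine TW.of_resolution (fun X _ _ => TW.BB R C X) (fun X Y _ _ _ _ e h => h.of_equiv e)
      (fun X Y Z _ _ _ _ _ _ f g h h1 h2 => TW.BB.coker h h1 h2) M n₁ G f₁ hf₁ (fun j => ?_) hz₁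
    obtain ⟨P, _, _, hP, ⟨e⟩⟩ := hG j
    exact (hCs.aa_projective (X := P)).toBB.of_equiv e.toLinearEquiv.symm
  have hMA : TW.AA R C M := by
    refine TW.of_coresolution (fun X _ _ => TW.AA R C X) (fun X Y _ _ _ _ e h => h.of_equiv e)
      (fun X Y Z _ _ _ _ _ _ f g h h1 h2 => TW.AA.ker h h1 h2) M n₂ J f₂ hf₂ (fun j => ?_) hz₂
    obtain ⟨I, _, _, hI, ⟨e⟩⟩ := hJ j
    exact (hCs.bb_injective (I := I)).toAA.of_equiv e.toLinearEquiv.symm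
  obtain ⟨eC⟩ := TW.equiv_ring hCs hMA hMB hM
  have hMA' : TW.AA R D M := by
    refine TW.of_resolution (fun X _ _ => TW.AA R D X) (fun X Y _ _ _ _ e h => h.of_equiv e)
      (fun X Y Z _ _ _ _ _ _ f g h h1 h2 => TW.AA.coker hDs.nv h h1 h2)
      M n₁ G f₁ hf₁ (fun j => ?_) hz₁
    obtain ⟨P, _, _, hP, ⟨e⟩⟩ := hG j
    exact (hDs.aa_projective (X := P)).of_equiv
      ((e.toLinearEquiv.trans (TensorProduct.congr eC (LinearEquiv.refl R P))).trans
        (TensorProduct.lid R P)).symm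
  have hMB' : TW.BB R D M := by
    refine TW.of_coresolution (fun X _ _ => TW.BB R D X) (fun X Y _ _ _ _ e h => h.of_equiv e)
      (fun X Y Z _ _ _ _ _ _ f g h h1 h2 => TW.BB.ker hDs.nv h h1 h2)
      M n₂ J f₂ hf₂ (fun j => ?_) hz₂
    obtain ⟨I, _, _, hI, ⟨e⟩⟩ := hJ j
    exact (hDs.bb_injective (I := I)).of_equiv
      ((e.toLinearEquiv.trans (LinearEquiv.arrowCongr eC (LinearEquiv.refl R I))).trans
        (LinearMap.ringLmapEquivSelf R R I)).symm
  obtain ⟨eD⟩ := TW.equiv_ring hDs hMA' hMB' hM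
  exact ⟨m, J₀, (HomologicalComplex.single (ModuleCat.{0} R) (ComplexShape.up ℕ) 0).map
    eD.symm.toModuleIso.hom ≫ f₀, inferInstance, hJ₀, hz₀⟩
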